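/- arXiv:2406.17098 — 2 statements merged into one kernel-verified Lean document; each statement's English description precedes it below -/
import Mathlib

section
/- Let P be a row-stochastic matrix on a finite nonempty state space S and γ ∈ (0,1). Then for every g ∈ S, occ γ P g g ≥ 1 − γ, and for all s, g ∈ S with s ≠ g, occ γ P s g ≤ γ · occ γ P g g. (These two bounds yield the identity property of the successor distance: the distance between distinct states is strictly positive.) -/
open scoped BigOperators

variable {S : Type*} [Fintype S] [DecidableEq S] [Nonempty S]

/-- `P` is a row-stochastic matrix. -/
def IsStochastic (P : Matrix S S ℝ) : Prop :=
  (∀ s s', 0 ≤ P s s') ∧ ∀ s, ∑ s', P s s' = 1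

/-- Discounted state occupancy measure `occ γ P s g = (1-γ) Σ_t γ^t (P^t) s g`. -/
noncomputable def occ (γ : ℝ) (P : Matrix S S ℝ) (s g : S) : ℝ :=
  (1 - γ) * ∑' t : ℕ, γ ^ t * (P ^ t) s g

/-- First-passage (hitting-time) probabilities of a Markov chain. -/
noncomputable def fp {X : Type*} [Fintype X] [DecidableEq X] (M : Matrix X X ℝ) :
    ℕ → X → X → ℝ
  | 0, x, y => if x = y then 1 else 0
  | h + 1, x, y => if x = y then 0 else ∑ x' : X, M x x' * fp M h x' y

/-- Laplace transform of the hitting time: `L γ M x y = Σ_h γ^h f h x y`. -/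
noncomputable def Lhit {X : Type*} [Fintype X] [DecidableEq X]
    (γ : ℝ) (M : Matrix X X ℝ) (x y : X) : ℝ :=
  ∑' h : ℕ, γ ^ h * fp M h x y

theorem pow_stoch_aux (P : Matrix S S ℝ) (hP : IsStochastic P) (t : ℕ) :
    (∀ s g, 0 ≤ (P ^ t) s g) ∧ ∀ s g, (P ^ t) s g ≤ 1 := by
  induction t with
  | zero =>
    constructor <;> intro s g <;> rw [pow_zero, Matrix.one_apply] <;> split_ifs <;> norm_num
  | succ n ih =>
    constructor
    · intro s g
      rw [pow_succ', Matrix.mul_apply]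
      exact Finset.sum_nonneg fun x _ => mul_nonneg (hP.1 s x) (ih.1 x g)
    · intro s g
      rw [pow_succ', Matrix.mul_apply, ← hP.2 s]
      exact Finset.sum_le_sum fun x _ => mul_le_of_le_one_right (hP.1 s x) (ih.2 x g)

theorem summable_aux (γ : ℝ) (hγ0 : 0 < γ) (hγ1 : γ < 1)
    (P : Matrix S S ℝ) (hP : IsStochastic P) (s g : S) :
    Summable fun t : ℕ => γ ^ t * (P ^ t) s g := by
  refine Summable.of_nonneg_of_le (fun t => ?_) (fun t => ?_)
    (summable_geometric_of_lt_one hγ0.le hγ1)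
  · exact mul_nonneg (pow_nonneg hγ0.le t) ((pow_stoch_aux P hP t).1 s g)
  · exact mul_le_of_le_one_right (pow_nonneg hγ0.le t) ((pow_stoch_aux P hP t).2 s g)

theorem bellman_aux (γ : ℝ) (hγ0 : 0 < γ) (hγ1 : γ < 1)
    (P : Matrix S S ℝ) (hP : IsStochastic P) (s g : S) :
    ∑' t : ℕ, γ ^ t * (P ^ t) s g = (if s = g then 1 else 0) +
      γ * ∑ x, P s x * ∑' t : ℕ, γ ^ t * (P ^ t) x g := by
  rw [(summable_aux γ hγ0 hγ1 P hP s g).tsum_eq_zero_add]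
  congr 1
  · simp [Matrix.one_apply]
  · simp_rw [← tsum_mul_left]
    rw [← Summable.tsum_finsetSum
      (fun x _ => (summable_aux γ hγ0 hγ1 P hP x g).mul_left (P s x)), ← tsum_mul_left]
    refine tsum_congr fun t => ?_
    rw [pow_succ' P, Matrix.mul_apply, Finset.mul_sum, Finset.mul_sum]
    refine Finset.sum_congr rfl fun x _ => ?_
    ring

/-- Bounds giving the identity property of the successor distance. -/
theorem occ_self_ge_and_occ_ne_le (γ : ℝ) (hγ0 : 0 < γ) (hγ1 : γ < 1)
    (P : Matrix S S ℝ) (hP : IsStochastic P) :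
    (∀ g : S, 1 - γ ≤ occ γ P g g) ∧
      (∀ s g : S, s ≠ g → occ γ P s g ≤ γ * occ γ P g g) := by
  have hnn : ∀ s g, 0 ≤ ∑' t : ℕ, γ ^ t * (P ^ t) s g := fun s g =>
    tsum_nonneg fun t => mul_nonneg (pow_nonneg hγ0.le t) ((pow_stoch_aux P hP t).1 s g)
  have hB := bellman_aux γ hγ0 hγ1 P hP
  have h1 : (0 : ℝ) ≤ 1 - γ := by linarith
  unfold occ
  constructor
  · intro g
    refine le_mul_of_one_le_right h1 ?_
    rw [hB g g, if_pos rfl]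
    have : 0 ≤ γ * ∑ x, P g x * ∑' t : ℕ, γ ^ t * (P ^ t) x g :=
      mul_nonneg hγ0.le (Finset.sum_nonneg fun x _ => mul_nonneg (hP.1 g x) (hnn x g))
    linarith
  · intro s g hsg
    have key : ∀ (C : ℝ), (∀ x, ∑' t : ℕ, γ ^ t * (P ^ t) x g ≤ C) → ∀ s, s ≠ g →
        ∑' t : ℕ, γ ^ t * (P ^ t) s g ≤ γ * C := by
      intro C hC s hs
      rw [hB s g, if_neg hs, zero_add]
      refine mul_le_mul_of_nonneg_left ?_ hγ0.le
      calc _ ≤ ∑ x, P s x * C :=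
            Finset.sum_le_sum fun x _ => mul_le_mul_of_nonneg_left (hC x) (hP.1 s x)
        _ = C := by rw [← Finset.sum_mul, hP.2 s, one_mul]
    obtain ⟨m, hm⟩ := Finite.exists_max fun x => ∑' t : ℕ, γ ^ t * (P ^ t) x g
    have hmax : ∀ x, ∑' t : ℕ, γ ^ t * (P ^ t) x g ≤ ∑' t : ℕ, γ ^ t * (P ^ t) g g := by
      intro x
      by_cases hmg : m = g
      · subst hmg
        exact hm x
      · have h2 := key _ hm m hmg
        have h3 := hm x
        have h4 := hnn g g
        nlinarith
    have := mul_le_mul_of_nonneg_left (key _ hmax s hsg) h1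
    linarith
end

section
/- Consider a controlled Markov process with finite nonempty state space S, finite nonempty action space A, row-stochastic dynamics P : S → A → S → ℝ, and discount γ ∈ (0,1). Then for all s, g ∈ S, the multiplicative successor value equals the optimal discounted Laplace transform of the hitting time: ⨆_{π ∈ Π} occ γ π s g / occ γ π g g = ⨆_{π ∈ Π} L γ P_π s g, where L γ P_π s g = Σ_{h=0}^∞ γ^h · f h s g is computed from the first-passage probabilities f of the induced chain P_π. (Hitting-time characterization exp(−d_SD(s,g)) = max_π E[γ^{H^π_s(g)}].) -/
open scoped BigOperators

variable {S A : Type*} [Fintype S] [DecidableEq S] [Nonempty S]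
  [Fintype A] [DecidableEq A] [Nonempty A]

/-- Row-stochastic controlled dynamics. -/
def IsDynamics (P : S → A → S → ℝ) : Prop :=
  (∀ s a s', 0 ≤ P s a s') ∧ ∀ s a, ∑ s', P s a s' = 1

/-- Stationary stochastic policy. -/
def IsPolicy (π : S → A → ℝ) : Prop :=
  (∀ s a, 0 ≤ π s a) ∧ ∀ s, ∑ a, π s a = 1

/-- The set of stationary stochastic policies, as a subtype. -/
abbrev Pol (S A : Type*) [Fintype A] : Type _ := {π : S → A → ℝ // IsPolicy π}

/-- State-transition matrix induced by policy `π`. -/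
noncomputable def Pmat (P : S → A → S → ℝ) (π : S → A → ℝ) : Matrix S S ℝ :=
  fun s s' => ∑ a, π s a * P s a s'

/-- Discounted state occupancy measure under policy `π`. -/
noncomputable def occC (γ : ℝ) (P : S → A → S → ℝ) (π : S → A → ℝ) (s g : S) : ℝ :=
  (1 - γ) * ∑' t : ℕ, γ ^ t * ((Pmat P π) ^ t) s g

lemma aux_pow_bound {X : Type*} [Fintype X] [DecidableEq X] (M : Matrix X X ℝ)
    (h0 : ∀ x y, 0 ≤ M x y) (h1 : ∀ x, ∑ y, M x y = 1) (g : X) (t : ℕ) :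
    ∀ x, 0 ≤ (M ^ t) x g ∧ (M ^ t) x g ≤ 1 := by
  induction t with
  | zero =>
    intro x
    rw [pow_zero, Matrix.one_apply]
    split_ifs <;> norm_num
  | succ t ih =>
    intro x
    rw [pow_succ', Matrix.mul_apply]
    refine ⟨Finset.sum_nonneg fun y _ => mul_nonneg (h0 x y) (ih y).1, ?_⟩
    rw [← h1 x]
    exact Finset.sum_le_sum fun y _ => mul_le_of_le_one_right (h0 x y) (ih y).2

lemma aux_fp_bound {X : Type*} [Fintype X] [DecidableEq X] (M : Matrix X X ℝ)
    (h0 : ∀ x y, 0 ≤ M x y) (h1 : ∀ x, ∑ y, M x y = 1) (g : X) (t : ℕ) :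
    ∀ x, 0 ≤ fp M t x g ∧ fp M t x g ≤ 1 := by
  induction t with
  | zero =>
    intro x
    rw [fp]
    split_ifs <;> norm_num
  | succ t ih =>
    intro x
    rw [fp]
    split_ifs
    · norm_num
    refine ⟨Finset.sum_nonneg fun y _ => mul_nonneg (h0 x y) (ih y).1, ?_⟩
    rw [← h1 x]
    exact Finset.sum_le_sum fun y _ => mul_le_of_le_one_right (h0 x y) (ih y).2

lemma aux_summable (γ : ℝ) (hγ0 : 0 < γ) (hγ1 : γ < 1) (u : ℕ → ℝ)
    (hu : ∀ t, 0 ≤ u t ∧ u t ≤ 1) : Summable fun t => γ ^ t * u t :=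
  Summable.of_nonneg_of_le (fun t => mul_nonneg (pow_nonneg hγ0.le t) (hu t).1)
    (fun t => mul_le_of_le_one_right (pow_nonneg hγ0.le t) (hu t).2)
    (summable_geometric_of_lt_one hγ0.le hγ1)

lemma aux_step {X : Type*} [Fintype X] (γ : ℝ) (c : X → ℝ) (u : ℕ → X → ℝ)
    (hs : ∀ y, Summable fun t => γ ^ t * u t y) :
    ∑' t : ℕ, γ ^ (t + 1) * ∑ y, c y * u t y =
      γ * ∑ y, c y * ∑' t : ℕ, γ ^ t * u t y := by
  have h1 : ∀ t : ℕ, γ ^ (t + 1) * ∑ y, c y * u t y =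
      γ * ∑ y, c y * (γ ^ t * u t y) := by
    intro t
    rw [Finset.mul_sum, Finset.mul_sum]
    exact Finset.sum_congr rfl fun y _ => by ring
  simp_rw [h1]
  rw [tsum_mul_left, Summable.tsum_finsetSum fun y _ => (hs y).mul_left (c y)]
  simp_rw [tsum_mul_left]

lemma aux_unique {X : Type*} [Fintype X] (γ : ℝ) (hγ0 : 0 < γ) (hγ1 : γ < 1)
    (M : Matrix X X ℝ) (h0 : ∀ x y, 0 ≤ M x y) (h1 : ∀ x, ∑ y, M x y = 1)
    (g : X) (D : X → ℝ) (hg : D g = 0)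
    (hD : ∀ x, x ≠ g → D x = γ * ∑ y, M x y * D y) (x : X) : D x = 0 := by
  haveI : Nonempty X := ⟨g⟩
  obtain ⟨m, hm⟩ := Finite.exists_max fun x => |D x|
  by_cases hmg : m = g
  · have := hm x
    rw [hmg, hg, abs_zero] at this
    exact abs_nonpos_iff.1 this
  have h2 : |D m| ≤ γ * |D m| := by
    conv_lhs => rw [hD m hmg, abs_mul, abs_of_pos hγ0]
    refine mul_le_mul_of_nonneg_left ?_ hγ0.le
    calc |∑ y, M m y * D y| ≤ ∑ y, |M m y * D y| := Finset.abs_sum_le_sum_abs _ _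
      _ ≤ ∑ y, M m y * |D m| := Finset.sum_le_sum fun y _ => by
          rw [abs_mul, abs_of_nonneg (h0 m y)]
          exact mul_le_mul_of_nonneg_left (hm y) (h0 m y)
      _ = |D m| := by rw [← Finset.sum_mul, h1, one_mul]
  have h3 : |D m| ≤ 0 := by nlinarith [abs_nonneg (D m)]
  exact abs_nonpos_iff.1 ((hm x).trans h3)

lemma aux_main {X : Type*} [Fintype X] [DecidableEq X] (γ : ℝ) (hγ0 : 0 < γ) (hγ1 : γ < 1)
    (M : Matrix X X ℝ) (h0 : ∀ x y, 0 ≤ M x y) (h1 : ∀ x, ∑ y, M x y = 1) (g s : X) :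
    1 ≤ ∑' t : ℕ, γ ^ t * (M ^ t) g g ∧
    ∑' t : ℕ, γ ^ t * (M ^ t) s g = Lhit γ M s g * ∑' t : ℕ, γ ^ t * (M ^ t) g g := by
  have sG : ∀ x, Summable fun t : ℕ => γ ^ t * (M ^ t) x g := fun x =>
    aux_summable γ hγ0 hγ1 _ fun t => aux_pow_bound M h0 h1 g t x
  have sL : ∀ x, Summable fun t : ℕ => γ ^ t * fp M t x g := fun x =>
    aux_summable γ hγ0 hγ1 _ fun t => aux_fp_bound M h0 h1 g t x
  constructor
  · have := (sG g).le_tsum 0 fun t _ =>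
      mul_nonneg (pow_nonneg hγ0.le t) (aux_pow_bound M h0 h1 g t g).1
    simpa using this
  have hLg : Lhit γ M g g = 1 := by
    rw [Lhit, (sL g).tsum_eq_zero_add]
    simp [fp]
  have hL : ∀ x, x ≠ g → Lhit γ M x g = γ * ∑ y, M x y * Lhit γ M y g := by
    intro x hx
    rw [Lhit, (sL x).tsum_eq_zero_add]
    simp only [fp, if_neg hx, mul_zero, zero_add]
    exact aux_step γ (M x) (fun t y => fp M t y g) sL
  have hG : ∀ x, x ≠ g → ∑' t : ℕ, γ ^ t * (M ^ t) x g =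
      γ * ∑ y, M x y * ∑' t : ℕ, γ ^ t * (M ^ t) y g := by
    intro x hx
    rw [(sG x).tsum_eq_zero_add]
    rw [pow_zero, pow_zero, Matrix.one_apply_ne hx, mul_zero, zero_add,
      ← aux_step γ (M x) (fun t y => (M ^ t) y g) sG]
    refine tsum_congr fun t => ?_
    rw [pow_succ' M, Matrix.mul_apply]
  have := aux_unique γ hγ0 hγ1 M h0 h1 g
    (fun x => ∑' t : ℕ, γ ^ t * (M ^ t) x g - Lhit γ M x g * ∑' t : ℕ, γ ^ t * (M ^ t) g g)
    (by simp [hLg]) (by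
      intro x hx
      simp only [mul_sub, Finset.sum_sub_distrib]
      rw [← hG x hx, hL x hx, mul_assoc, Finset.sum_mul]
      simp only [mul_assoc]) s
  exact sub_eq_zero.1 this

/-- The multiplicative successor value equals the optimal discounted Laplace
transform of the hitting time. -/
theorem Dval_eq_sup_Lhit (γ : ℝ) (hγ0 : 0 < γ) (hγ1 : γ < 1)
    (P : S → A → S → ℝ) (hP : IsDynamics P) (s g : S) :
    (⨆ π : Pol S A, occC γ P π.1 s g / occC γ P π.1 g g) =
      ⨆ π : Pol S A, Lhit γ (Pmat P π.1) s g := by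
  congr 1
  funext π
  have h0 : ∀ x y, 0 ≤ Pmat P π.1 x y := fun x y =>
    Finset.sum_nonneg fun a _ => mul_nonneg (π.2.1 x a) (hP.1 x a y)
  have h1 : ∀ x, ∑ y, Pmat P π.1 x y = 1 := by
    intro x
    simp only [Pmat]
    rw [Finset.sum_comm]
    simp only [← Finset.mul_sum, hP.2, mul_one]
    exact π.2.2 x
  obtain ⟨h2, h3⟩ := aux_main γ hγ0 hγ1 (Pmat P π.1) h0 h1 g s
  have h4 : (1 - γ) ≠ 0 := by linarith
  rw [occC, occC, mul_div_mul_left _ _ h4, h3, mul_div_assoc, div_self (by linarith), mul_one]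
end
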